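/- Let θ1 ≥ 1 and θ2 ≤ −2 be integers, and define the real numbers θ0 = (θ1(θ1²+θ1+1) − 2θ2(θ1+1) + θ1·√((θ1²+θ1+1)² − 4θ1·θ2(θ1+1)))/2 and e0 = θ0 + θ2. Suppose that y = (e0 − θ1³ + θ1·θ2)/θ1, x = y − θ1, λ = −θ2·(x−1)/θ1, r = λ − θ1·θ2, k = y + θ1², v = −θ2·(θ0 − θ1)/λ and b = r − k + e0 + 1 are all integers, with v, b, k, r, λ positive and x, y nonnegative. Suppose M is a v×b {0,1}-matrix with all row sums r and all column sums k satisfying M·Mᵀ = (r−λ)·I + λ·J, and X is a symmetric b×b {0,1}-matrix with zero diagonal, X ≠ O and X ≠ J−I, satisfying Mᵀ·M = k·I + x·X + y·(J − I − X). Then the graph on v+b vertices with block adjacency matrix [[O, M],[Mᵀ, X]] is connected and its set of adjacency eigenvalues is exactly {θ0, θ1, θ2}. Furthermore, if r ≠ k + θ0 + θ2 then this graph has coherent rank 9. -/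

import Mathlib

open Matrix

/-- `θ` is an eigenvalue of the (real) adjacency matrix of `G`. -/
def adjEig {V : Type} [Fintype V] [DecidableEq V] (G : SimpleGraph V) [DecidableRel G.Adj]
    (θ : ℝ) : Prop :=
  ∃ f : V → ℝ, f ≠ 0 ∧ (SimpleGraph.adjMatrix ℝ G).mulVec f = θ • f

/-- `Γ ∈ 𝒢₃(θ0,θ1,θ2)`: `Γ` is connected and the set of eigenvalues of its adjacency
matrix is exactly `{θ0, θ1, θ2}`, where `θ0 > θ1 > θ2`. -/
def InG3 {V : Type} [Fintype V] [DecidableEq V] (G : SimpleGraph V) [DecidableRel G.Adj]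
    (θ0 θ1 θ2 : ℝ) : Prop :=
  G.Connected ∧ θ1 < θ0 ∧ θ2 < θ1 ∧ {θ : ℝ | adjEig G θ} = {θ0, θ1, θ2}

/-- A coherent configuration of rank `r` on the finite set `V`, given as a family of
`{0,1}`-matrices `A 1, …, A r`. -/
def IsCoherentConfig {V : Type} [Fintype V] [DecidableEq V] {r : ℕ}
    (A : Fin r → Matrix V V ℝ) : Prop :=
  (∀ i x y, A i x y = 0 ∨ A i x y = 1) ∧
  (∑ i, A i) = Matrix.of (fun _ _ => (1 : ℝ)) ∧
  (∀ i, ∃ j, (A i)ᵀ = A j) ∧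
  (∃ Δ : Finset (Fin r), ∑ i ∈ Δ, A i = 1) ∧
  (∀ i j, A i * A j ∈ Submodule.span ℝ (Set.range A))

/-- The coherent rank of `G` is `n`: `n` is the least rank of a coherent configuration on
the vertex set of `G` whose real linear span contains the adjacency matrix of `G`. -/
def HasCoherentRank {V : Type} [Fintype V] [DecidableEq V] (G : SimpleGraph V)
    [DecidableRel G.Adj] (n : ℕ) : Prop :=
  IsLeast {r : ℕ | ∃ A : Fin r → Matrix V V ℝ,
    IsCoherentConfig A ∧ SimpleGraph.adjMatrix ℝ G ∈ Submodule.span ℝ (Set.range A)} n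

section AllOnes

/-- The all-ones matrix. -/
abbrev allOnes (m n : Type*) : Matrix m n ℝ := Matrix.of fun _ _ => 1

theorem mul_allOnes {l m n : Type*} [Fintype m] {M : Matrix l m ℝ} {r : ℝ}
    (h : ∀ i, ∑ j, M i j = r) : M * allOnes m n = r • allOnes l n := by
  ext i j
  simp [Matrix.mul_apply, h]

theorem allOnes_mul {l m n : Type*} [Fintype m] {M : Matrix m n ℝ} {k : ℝ}
    (h : ∀ j, ∑ i, M i j = k) : allOnes l m * M = k • allOnes l n := by
  ext i j
  simp [Matrix.mul_apply, h]

theorem sum_col_eq_of_transpose_eq {n : Type*} [Fintype n] {X : Matrix n n ℝ} {e : ℝ}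
    (hX : Xᵀ = X) (h : ∀ i, ∑ j, X i j = e) (j : n) : ∑ i, X i j = e := by
  rw [← hX]
  exact h j

/-- Nonzero `{0,1}`-matrices which sum to the all-ones matrix are linearly independent. -/
theorem linearIndependent_of_sum_eq_allOnes {m n ι : Type*} [Fintype ι] {B : ι → Matrix m n ℝ}
    (h01 : ∀ i x y, B i x y = 0 ∨ B i x y = 1) (hsum : ∑ i, B i = allOnes m n)
    (hne : ∀ i, B i ≠ 0) : LinearIndependent ℝ B := by
  classical
  rw [Fintype.linearIndependent_iff]
  intro c hc i
  obtain ⟨x, y, hxy⟩ : ∃ x y, B i x y ≠ 0 := by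
    by_contra! h
    exact hne i (Matrix.ext h)
  have hi : B i x y = 1 := (h01 i x y).resolve_left hxy
  have hs : ∑ j, B j x y = 1 := by
    simpa [Matrix.sum_apply] using congrFun (congrFun hsum x) y
  have hrest : ∑ j ∈ Finset.univ.erase i, B j x y = 0 := by
    rw [← Finset.add_sum_erase _ _ (Finset.mem_univ i), hi] at hs
    linarith
  have hnonneg : ∀ j ∈ Finset.univ.erase i, 0 ≤ B j x y := fun j _ => by
    rcases h01 j x y with h | h <;> simp [h]
  have h0 := (Finset.sum_eq_zero_iff_of_nonneg hnonneg).1 hrest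
  have hcxy : ∑ j, c j * B j x y = 0 := by
    simpa [Matrix.sum_apply] using congrFun (congrFun hc x) y
  rw [Finset.sum_eq_single i (fun j _ hj => by simp [h0 j (by simp [hj])]) (by simp), hi] at hcxy
  simpa using hcxy

theorem LinearIndependent.card_le_of_mem_span {E ι κ : Type*} [AddCommGroup E] [Module ℝ E]
    [Fintype ι] [Fintype κ] {B : ι → E} {A : κ → E} (hB : LinearIndependent ℝ B)
    (hmem : ∀ i, B i ∈ Submodule.span ℝ (Set.range A)) : Fintype.card ι ≤ Fintype.card κ := by
  have hle : Submodule.span ℝ (Set.range B) ≤ Submodule.span ℝ (Set.range A) :=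
    Submodule.span_le.2 (by rintro _ ⟨i, rfl⟩; exact hmem i)
  have := FiniteDimensional.span_of_finite ℝ (Set.finite_range A)
  calc Fintype.card ι = Module.finrank ℝ (Submodule.span ℝ (Set.range B)) :=
        (finrank_span_eq_card hB).symm
    _ ≤ Module.finrank ℝ (Submodule.span ℝ (Set.range A)) := Submodule.finrank_mono hle
    _ ≤ Fintype.card κ := finrank_range_le_card A

end AllOnes

namespace IsCoherentConfig

variable {V : Type} [Fintype V] [DecidableEq V] {r : ℕ} {A : Fin r → Matrix V V ℝ}

theorem one_mem_span (hA : IsCoherentConfig A) :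
    (1 : Matrix V V ℝ) ∈ Submodule.span ℝ (Set.range A) := by
  obtain ⟨Δ, hΔ⟩ := hA.2.2.2.1
  exact hΔ ▸ Submodule.sum_mem _ fun i _ => Submodule.subset_span ⟨i, rfl⟩

theorem allOnes_mem_span (hA : IsCoherentConfig A) :
    allOnes V V ∈ Submodule.span ℝ (Set.range A) := by
  rw [allOnes, ← hA.2.1]
  exact Submodule.sum_mem _ fun i _ => Submodule.subset_span ⟨i, rfl⟩

theorem mul_mem_span (hA : IsCoherentConfig A) {P Q : Matrix V V ℝ}
    (hP : P ∈ Submodule.span ℝ (Set.range A)) (hQ : Q ∈ Submodule.span ℝ (Set.range A)) :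
    P * Q ∈ Submodule.span ℝ (Set.range A) := by
  refine LinearMap.BilinMap.apply_apply_mem_of_mem_span _ _ _ (LinearMap.mul ℝ (Matrix V V ℝ))
    ?_ P Q hP hQ
  rintro _ ⟨i, rfl⟩ _ ⟨j, rfl⟩
  exact hA.2.2.2.2 i j

theorem hadamard_eq (hA : IsCoherentConfig A) (i j : Fin r) :
    A i ⊙ A j = if i = j then A i else 0 := by
  ext x y
  have hs : ∑ l, A l x y = 1 := by
    simpa [Matrix.sum_apply] using congrFun (congrFun hA.2.1 x) y
  have hnonneg : ∀ l, 0 ≤ A l x y := fun l => by rcases hA.1 l x y with h | h <;> simp [h]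
  split_ifs with hij
  · subst hij
    rcases hA.1 i x y with h | h <;> simp [h]
  · have hle : A i x y + A j x y ≤ 1 := by
      rw [← hs, ← Finset.sum_pair (f := fun l => A l x y) hij]
      exact Finset.sum_le_sum_of_subset_of_nonneg (Finset.subset_univ _) fun l _ _ => hnonneg l
    rcases hA.1 i x y with h | h <;> rcases hA.1 j x y with h' | h' <;> simp [h, h']
    linarith

theorem hadamard_mem_span (hA : IsCoherentConfig A) {P Q : Matrix V V ℝ}
    (hP : P ∈ Submodule.span ℝ (Set.range A)) (hQ : Q ∈ Submodule.span ℝ (Set.range A)) :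
    P ⊙ Q ∈ Submodule.span ℝ (Set.range A) := by
  refine LinearMap.BilinMap.apply_apply_mem_of_mem_span _ _ _
    (LinearMap.mk₂ ℝ (fun P Q : Matrix V V ℝ => P ⊙ Q) (fun _ _ _ => Matrix.add_hadamard ..)
      (fun _ _ _ => Matrix.smul_hadamard ..) (fun _ _ _ => Matrix.hadamard_add ..)
      (fun _ _ _ => Matrix.hadamard_smul ..)) ?_ P Q hP hQ
  rintro _ ⟨i, rfl⟩ _ ⟨j, rfl⟩
  rw [LinearMap.mk₂_apply, hA.hadamard_eq]
  split_ifs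
  · exact Submodule.subset_span ⟨i, rfl⟩
  · exact Submodule.zero_mem _

end IsCoherentConfig

section Design

variable {m n : Type} [DecidableEq m] [DecidableEq n]

/-- The nine relations of the coherent configuration attached to an incidence matrix `M` and a
graph on blocks with adjacency matrix `X`. -/
noncomputable def designConfig (M : Matrix m n ℝ) (X : Matrix n n ℝ) :
    Fin 9 → Matrix (m ⊕ n) (m ⊕ n) ℝ :=
  ![fromBlocks 1 0 0 0, fromBlocks (allOnes m m - 1) 0 0 0,
    fromBlocks 0 M 0 0, fromBlocks 0 (allOnes m n - M) 0 0,
    fromBlocks 0 0 Mᵀ 0, fromBlocks 0 0 (allOnes n m - Mᵀ) 0,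
    fromBlocks 0 0 0 1, fromBlocks 0 0 0 X, fromBlocks 0 0 0 (allOnes n n - 1 - X)]

/-- A block matrix whose blocks are combinations of `1`, `M`, `Mᵀ`, `X` and all-ones matrices. -/
noncomputable def designCombination (M : Matrix m n ℝ) (X : Matrix n n ℝ) (a : Fin 9 → ℝ) :
    Matrix (m ⊕ n) (m ⊕ n) ℝ :=
  fromBlocks (a 0 • (1 : Matrix m m ℝ) + a 1 • allOnes m m) (a 2 • M + a 3 • allOnes m n)
    (a 4 • Mᵀ + a 5 • allOnes n m) (a 6 • (1 : Matrix n n ℝ) + a 7 • X + a 8 • allOnes n n)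

theorem designConfig_eq_designCombination (M : Matrix m n ℝ) (X : Matrix n n ℝ) (i : Fin 9) :
    ∃ a, designConfig M X i = designCombination M X a := by
  fin_cases i
  · exact ⟨![1, 0, 0, 0, 0, 0, 0, 0, 0], by simp [designConfig, designCombination]⟩
  · exact ⟨![-1, 1, 0, 0, 0, 0, 0, 0, 0], by
      simp [designConfig, designCombination, sub_eq_neg_add]⟩
  · exact ⟨![0, 0, 1, 0, 0, 0, 0, 0, 0], by simp [designConfig, designCombination]⟩
  · exact ⟨![0, 0, -1, 1, 0, 0, 0, 0, 0], by
      simp [designConfig, designCombination, sub_eq_neg_add]⟩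
  · exact ⟨![0, 0, 0, 0, 1, 0, 0, 0, 0], by simp [designConfig, designCombination]⟩
  · exact ⟨![0, 0, 0, 0, -1, 1, 0, 0, 0], by
      simp [designConfig, designCombination, sub_eq_neg_add]⟩
  · exact ⟨![0, 0, 0, 0, 0, 0, 1, 0, 0], by simp [designConfig, designCombination]⟩
  · exact ⟨![0, 0, 0, 0, 0, 0, 0, 1, 0], by simp [designConfig, designCombination]⟩
  · exact ⟨![0, 0, 0, 0, 0, 0, -1, -1, 1], by
      simp [designConfig, designCombination]; abel⟩

theorem designCombination_mem_span (M : Matrix m n ℝ) (X : Matrix n n ℝ) (a : Fin 9 → ℝ) :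
    designCombination M X a ∈ Submodule.span ℝ (Set.range (designConfig M X)) := by
  rw [Submodule.mem_span_range_iff_exists_fun]
  refine ⟨![a 0 + a 1, a 1, a 2 + a 3, a 3, a 4 + a 5, a 5, a 6 + a 8, a 7 + a 8, a 8], ?_⟩
  ext (p | p) (q | q) <;>
  · simp [Fin.sum_univ_succ, designConfig, designCombination, Matrix.add_apply]
    ring

variable [Fintype m] [Fintype n]

/-- `M` is the incidence matrix of a design with replication number `r` and block size `k`, and
`X` is the adjacency matrix of a regular graph of valency `e` on its blocks, such that
`[[O, M], [Mᵀ, X]]` satisfies a quadratic equation with roots `t` and `s`, up to a matrix which is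
constant on blocks. -/
structure IsDesignWithBlockGraph (M : Matrix m n ℝ) (X : Matrix n n ℝ)
    (t s lam r k e y c d : ℝ) : Prop where
  row_sum : ∀ i, ∑ j, M i j = r
  col_sum : ∀ j, ∑ i, M i j = k
  deg : ∀ i, ∑ j, X i j = e
  symm : Xᵀ = X
  mul_transpose : M * Mᵀ = -(t * s) • (1 : Matrix m m ℝ) + lam • allOnes m m
  transpose_mul : Mᵀ * M = t ^ 2 • (1 : Matrix n n ℝ) - t • X + y • allOnes n n
  mul_block : M * X = (t + s) • M + c • allOnes m n
  block_sq : X * X = (2 * t + s) • X - (t * s + t ^ 2) • (1 : Matrix n n ℝ)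
    + (d - y) • allOnes n n

namespace IsDesignWithBlockGraph

variable {M : Matrix m n ℝ} {X : Matrix n n ℝ} {t s lam r k e y c d : ℝ}

theorem block_mul (h : IsDesignWithBlockGraph M X t s lam r k e y c d) :
    X * Mᵀ = (t + s) • Mᵀ + c • allOnes n m := by
  have := congrArg transpose h.mul_block
  rw [Matrix.transpose_mul, h.symm] at this
  rw [this]
  ext
  simp

theorem designCombination_mul (h : IsDesignWithBlockGraph M X t s lam r k e y c d)
    (a a' : Fin 9 → ℝ) :
    ∃ a'', designCombination M X a * designCombination M X a' = designCombination M X a'' := by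
  have mul_J : ∀ l : Type, M * allOnes n l = r • allOnes m l :=
    fun _ => mul_allOnes h.row_sum
  have J_mul : ∀ l : Type, allOnes l m * M = k • allOnes l n :=
    fun _ => allOnes_mul h.col_sum
  have tr_mul_J : ∀ l : Type, Mᵀ * allOnes m l = k • allOnes n l :=
    fun _ => mul_allOnes h.col_sum
  have J_mul_tr : ∀ l : Type, allOnes l n * Mᵀ = r • allOnes l m :=
    fun _ => allOnes_mul h.row_sum
  have X_mul_J : ∀ l : Type, X * allOnes n l = e • allOnes n l :=
    fun _ => mul_allOnes h.deg
  have J_mul_X : ∀ l : Type, allOnes l n * X = e • allOnes l n :=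
    fun _ => allOnes_mul (sum_col_eq_of_transpose_eq h.symm h.deg)
  have J_mul_J_m : ∀ l l' : Type,
      allOnes l m * allOnes m l' = (Fintype.card m : ℝ) • allOnes l l' :=
    fun _ _ => mul_allOnes (by simp)
  have J_mul_J_n : ∀ l l' : Type,
      allOnes l n * allOnes n l' = (Fintype.card n : ℝ) • allOnes l l' :=
    fun _ _ => mul_allOnes (by simp)
  refine ⟨![a 0 * a' 0 - t * s * (a 2 * a' 4),
    a 0 * a' 1 + a 1 * a' 0 + Fintype.card m * (a 1 * a' 1) + lam * (a 2 * a' 4)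
      + r * (a 2 * a' 5) + r * (a 3 * a' 4) + Fintype.card n * (a 3 * a' 5),
    a 0 * a' 2 + a 2 * a' 6 + (t + s) * (a 2 * a' 7),
    a 0 * a' 3 + k * (a 1 * a' 2) + Fintype.card m * (a 1 * a' 3) + c * (a 2 * a' 7)
      + r * (a 2 * a' 8) + a 3 * a' 6 + e * (a 3 * a' 7) + Fintype.card n * (a 3 * a' 8),
    a 4 * a' 0 + a 6 * a' 4 + (t + s) * (a 7 * a' 4),
    k * (a 4 * a' 1) + a 5 * a' 0 + Fintype.card m * (a 5 * a' 1) + a 6 * a' 5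
      + c * (a 7 * a' 4) + e * (a 7 * a' 5) + r * (a 8 * a' 4) + Fintype.card n * (a 8 * a' 5),
    t ^ 2 * (a 4 * a' 2) + a 6 * a' 6 - (t * s + t ^ 2) * (a 7 * a' 7),
    -t * (a 4 * a' 2) + a 6 * a' 7 + a 7 * a' 6 + (2 * t + s) * (a 7 * a' 7),
    y * (a 4 * a' 2) + k * (a 4 * a' 3) + k * (a 5 * a' 2) + Fintype.card m * (a 5 * a' 3)
      + a 6 * a' 8 + (d - y) * (a 7 * a' 7) + e * (a 7 * a' 8) + a 8 * a' 6 + e * (a 8 * a' 7)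
      + Fintype.card n * (a 8 * a' 8)], ?_⟩
  simp only [designCombination, fromBlocks_multiply, fromBlocks_inj, Matrix.cons_val]
  refine ⟨?_, ?_, ?_, ?_⟩ <;>
  · simp only [Matrix.mul_add, Matrix.add_mul, Matrix.smul_mul, Matrix.mul_smul, Matrix.one_mul,
      Matrix.mul_one, mul_J, J_mul, tr_mul_J, J_mul_tr, X_mul_J, J_mul_X, J_mul_J_m, J_mul_J_n,
      h.block_mul, h.mul_transpose, h.transpose_mul, h.mul_block, h.block_sq]
    module

theorem isCoherentConfig (h : IsDesignWithBlockGraph M X t s lam r k e y c d)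
    (hM01 : ∀ i j, M i j = 0 ∨ M i j = 1) (hX01 : ∀ i j, X i j = 0 ∨ X i j = 1)
    (hXdiag : ∀ i, X i i = 0) : IsCoherentConfig (designConfig M X) := by
  refine ⟨?_, ?_, ?_, ⟨{0, 6}, ?_⟩, ?_⟩
  · intro i p q
    fin_cases i <;> rcases p with p | p <;> rcases q with q | q <;>
      simp [designConfig, hM01, hX01, Matrix.one_apply, or_comm, eq_comm]
    all_goals grind
  · ext (p | p) (q | q) <;> simp [Fin.sum_univ_succ, designConfig]
  · intro i
    have hX := h.symm
    have hJ : ∀ l l' : Type, (allOnes l l')ᵀ = allOnes l' l := fun _ _ => rfl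
    fin_cases i
    exacts [⟨0, by simp [designConfig, fromBlocks_transpose]⟩,
      ⟨1, by simp [designConfig, fromBlocks_transpose, hJ]⟩,
      ⟨4, by simp [designConfig, fromBlocks_transpose]⟩,
      ⟨5, by simp [designConfig, fromBlocks_transpose, hJ]⟩,
      ⟨2, by simp [designConfig, fromBlocks_transpose]⟩,
      ⟨3, by simp [designConfig, fromBlocks_transpose, hJ]⟩,
      ⟨6, by simp [designConfig, fromBlocks_transpose]⟩,
      ⟨7, by simp [designConfig, fromBlocks_transpose, hX]⟩,
      ⟨8, by simp [designConfig, fromBlocks_transpose, hJ, hX]⟩]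
  · simp [designConfig, fromBlocks_add]
  · intro i j
    obtain ⟨a, ha⟩ := designConfig_eq_designCombination M X i
    obtain ⟨a', ha'⟩ := designConfig_eq_designCombination M X j
    obtain ⟨a'', ha''⟩ := h.designCombination_mul a a'
    rw [ha, ha', ha'']
    exact designCombination_mem_span M X a''

theorem of_quasiSymmetric {b : ℝ} (hb : Fintype.card n = b) (ht : t ≠ 0)
    (row_sum : ∀ i, ∑ j, M i j = r) (col_sum : ∀ j, ∑ i, M i j = k) (symm : Xᵀ = X)
    (mul_transpose : M * Mᵀ = -(t * s) • (1 : Matrix m m ℝ) + lam • allOnes m m)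
    (transpose_mul : Mᵀ * M = t ^ 2 • (1 : Matrix n n ℝ) - t • X + y • allOnes n n) :
    ∃ c d, IsDesignWithBlockGraph M X t s lam r k ((t ^ 2 + y * b - r * k) / t) y c d := by
  have mul_J : ∀ l : Type, M * allOnes n l = r • allOnes m l :=
    fun _ => mul_allOnes row_sum
  have J_mul : ∀ l : Type, allOnes l m * M = k • allOnes l n :=
    fun _ => allOnes_mul col_sum
  have tr_mul_J : ∀ l : Type, Mᵀ * allOnes m l = k • allOnes n l :=
    fun _ => mul_allOnes col_sum
  have J_mul_J : ∀ l l' : Type, allOnes l n * allOnes n l' = b • allOnes l l' :=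
    fun _ _ => mul_allOnes (by simp [hb])
  have hX : X = t • (1 : Matrix n n ℝ) + (y / t) • allOnes n n - t⁻¹ • (Mᵀ * M) := by
    rw [transpose_mul]
    match_scalars <;> field_simp <;> ring
  have mul_block : M * X = (t + s) • M + ((y * r - lam * k) / t) • allOnes m n := by
    rw [hX]
    simp only [Matrix.mul_add, Matrix.mul_sub, Matrix.mul_smul, ← Matrix.mul_assoc,
      mul_transpose, Matrix.add_mul, Matrix.smul_mul, Matrix.one_mul, Matrix.mul_one, mul_J, J_mul]
    match_scalars <;> field_simp
    ring
  have block_mul_J : ∀ l : Type,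
      X * allOnes n l = ((t ^ 2 + y * b - r * k) / t) • allOnes n l := fun l => by
    rw [hX]
    simp only [Matrix.add_mul, Matrix.sub_mul, Matrix.smul_mul, Matrix.one_mul, Matrix.mul_assoc,
      mul_J, tr_mul_J, Matrix.mul_smul, J_mul_J]
    match_scalars
    field_simp
  refine ⟨(y * r - lam * k) / t, y + (y * ((t ^ 2 + y * b - r * k) / t) - (t + s) * y
    - (y * r - lam * k) / t * k) / t, row_sum, col_sum, fun i => ?_, symm,
    mul_transpose, transpose_mul, mul_block, ?_⟩
  · simpa [Matrix.mul_apply] using congrFun (congrFun (block_mul_J Unit) i) ()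
  · have hXX : X * X = t • X + (y / t) • (allOnes n n * X) - t⁻¹ • (Mᵀ * (M * X)) := by
      conv_lhs => enter [1]; rw [hX]
      simp only [Matrix.add_mul, Matrix.sub_mul, Matrix.smul_mul, Matrix.one_mul,
        Matrix.mul_assoc]
    have J_mul_X : allOnes n n * X = ((t ^ 2 + y * b - r * k) / t) • allOnes n n := by
      have := congrArg transpose (block_mul_J n)
      rwa [Matrix.transpose_mul, symm] at this
    rw [hXX, J_mul_X, mul_block, Matrix.mul_add, Matrix.mul_smul, Matrix.mul_smul, tr_mul_J,
      transpose_mul]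
    match_scalars <;> field_simp <;> ring

theorem connected (h : IsDesignWithBlockGraph M X t s lam r k e y c d) [Nonempty m]
    (hlam : lam ≠ 0) (hk : k ≠ 0) {G : SimpleGraph (m ⊕ n)} [DecidableRel G.Adj]
    (hG : G.adjMatrix ℝ = fromBlocks 0 M Mᵀ X) : G.Connected := by
  have hadj : ∀ p j, M p j ≠ 0 → G.Adj (.inl p) (.inr j) := fun p j hpj => by
    have := congrFun (congrFun hG (.inl p)) (.inr j)
    by_contra hn
    simp [hn, hpj.symm] at this
  have hpoints : ∀ p q, G.Reachable (.inl p) (.inl q) := fun p q => by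
    by_cases hpq : p = q
    · rw [hpq]
    have hsum : ∑ j, M p j * M q j ≠ 0 := by
      have := congrFun (congrFun h.mul_transpose p) q
      simp [Matrix.mul_apply, hpq] at this
      rwa [this]
    obtain ⟨j, -, hj⟩ := Finset.exists_ne_zero_of_sum_ne_zero hsum
    exact (hadj p j (left_ne_zero_of_mul hj)).reachable.trans
      (hadj q j (right_ne_zero_of_mul hj)).symm.reachable
  have hreach : ∀ u p, G.Reachable (.inl p) u := by
    rintro (q | j) p
    · exact hpoints p q
    · obtain ⟨q, -, hq⟩ := Finset.exists_ne_zero_of_sum_ne_zero ((h.col_sum j).trans_ne hk)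
      exact (hpoints p q).trans (hadj q j hq).reachable
  have p := Classical.arbitrary m
  have : Nonempty (m ⊕ n) := ⟨.inl p⟩
  exact ⟨fun u w => (hreach u p).symm.trans (hreach w p)⟩

theorem adj_sq (h : IsDesignWithBlockGraph M X t s lam r k e y c d) :
    fromBlocks 0 M Mᵀ X * fromBlocks 0 M Mᵀ X - (t + s) • fromBlocks 0 M Mᵀ X
      + (t * s) • (1 : Matrix (m ⊕ n) (m ⊕ n) ℝ)
      = fromBlocks (lam • allOnes m m) (c • allOnes m n) (c • allOnes n m) (d • allOnes n n) := by
  rw [← fromBlocks_one, fromBlocks_multiply, sub_eq_add_neg, fromBlocks_smul, fromBlocks_neg,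
    fromBlocks_smul, fromBlocks_add, fromBlocks_add, fromBlocks_inj]
  simp only [Matrix.zero_mul, Matrix.mul_zero, zero_add, h.mul_transpose, h.transpose_mul,
    h.mul_block, h.block_sq, h.block_mul]
  refine ⟨?_, ?_, ?_, ?_⟩ <;> module

theorem adj_mulVec_elim_const (h : IsDesignWithBlockGraph M X t s lam r k e y c d) (p q : ℝ) :
    fromBlocks 0 M Mᵀ X *ᵥ Sum.elim (fun _ => p) (fun _ => q)
      = Sum.elim (fun _ => r * q) (fun _ => k * p + e * q) := by
  rw [fromBlocks_mulVec]
  congr 1 <;> ext i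
  · simp [mulVec, dotProduct, ← Finset.sum_mul, h.row_sum]
  · simp [mulVec, dotProduct, ← Finset.sum_mul, h.col_sum, h.deg]

theorem eigenvalue_eq (h : IsDesignWithBlockGraph M X t s lam r k e y c d) [Nonempty m]
    [Nonempty n] {θ : ℝ} (hk : k ≠ 0) (he : e = θ + s) (hrk : r * k = -(θ * s))
    {z : ℝ} {f : m ⊕ n → ℝ} (hf : f ≠ 0) (hz : fromBlocks 0 M Mᵀ X *ᵥ f = z • f) :
    z = θ ∨ z = t ∨ z = s := by
  by_cases hts : (z - t) * (z - s) = 0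
  · rcases mul_eq_zero.1 hts with h' | h'
    · exact Or.inr (Or.inl (sub_eq_zero.1 h'))
    · exact Or.inr (Or.inr (sub_eq_zero.1 h'))
  have hsq := congrArg (· *ᵥ f) h.adj_sq
  simp only [add_mulVec, sub_mulVec, smul_mulVec, one_mulVec, ← mulVec_mulVec, hz,
    mulVec_smul] at hsq
  obtain ⟨p, q, rfl⟩ : ∃ p q : ℝ, f = Sum.elim (fun _ => p) (fun _ => q) := by
    refine ⟨((z - t) * (z - s))⁻¹ * (lam * ∑ i, f (.inl i) + c * ∑ j, f (.inr j)),
      ((z - t) * (z - s))⁻¹ * (c * ∑ i, f (.inl i) + d * ∑ j, f (.inr j)), ?_⟩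
    ext u
    rw [← Sum.elim_comp_inl_inr f, fromBlocks_mulVec] at hsq
    have hu := congrFun hsq u
    rcases u with u | u <;>
    · simp [mulVec, dotProduct, ← Finset.mul_sum] at hu
      simp only [Sum.elim_inl, Sum.elim_inr]
      rw [← hu, eq_inv_mul_iff_mul_eq₀ hts]
      ring
  rw [h.adj_mulVec_elim_const] at hz
  have hl : r * q = z * p := by simpa using congrFun hz (.inl (Classical.arbitrary m))
  have hr : k * p + e * q = z * q := by simpa using congrFun hz (.inr (Classical.arbitrary n))
  have hq : q ≠ 0 := by
    rintro rfl
    obtain rfl : p = 0 := by simpa [hk] using hr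
    exact hf (by ext u; rcases u with u | u <;> simp)
  have hzθ : q * ((z - θ) * (z - s)) = 0 := by
    linear_combination -z * hr - k * hl + z * q * he + q * hrk
  rcases mul_eq_zero.1 ((mul_eq_zero.1 hzθ).resolve_left hq) with h' | h'
  · exact Or.inl (sub_eq_zero.1 h')
  · exact Or.inr (Or.inr (sub_eq_zero.1 h'))

theorem adj_mulVec_quotient (h : IsDesignWithBlockGraph M X t s lam r k e y c d) {z : ℝ}
    (hz : z ^ 2 = e * z + r * k) :
    fromBlocks 0 M Mᵀ X *ᵥ Sum.elim (fun _ => r) (fun _ => z)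
      = z • Sum.elim (fun _ => r) (fun _ => z) := by
  rw [h.adj_mulVec_elim_const]
  ext u
  rcases u with u | u
  · simp [mul_comm]
  · simp only [Sum.elim_inr, Pi.smul_apply, smul_eq_mul]
    linear_combination -hz

theorem exists_eigenvector (h : IsDesignWithBlockGraph M X t s lam r k e y c d) [Nontrivial m]
    (hs : s ≠ 0) : ∃ f : m ⊕ n → ℝ, f ≠ 0 ∧ fromBlocks 0 M Mᵀ X *ᵥ f = t • f := by
  obtain ⟨i, j, hij⟩ := exists_pair_ne m
  let u : m → ℝ := Pi.single i 1 - Pi.single j 1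
  let f : m ⊕ n → ℝ := Sum.elim u 0
  have hsq := congrArg (· *ᵥ f) h.adj_sq
  have hu : ∑ i, u i = 0 := by simp [u]
  have h0 : fromBlocks (lam • allOnes m m) (c • allOnes m n) (c • allOnes n m)
      (d • allOnes n n) *ᵥ f = 0 := by
    rw [fromBlocks_mulVec]
    ext w
    rcases w with w | w <;> simp [f, mulVec, dotProduct, ← Finset.mul_sum, hu]
  simp only [h0, add_mulVec, sub_mulVec, smul_mulVec, one_mulVec, ← mulVec_mulVec] at hsq
  refine ⟨fromBlocks 0 M Mᵀ X *ᵥ f - s • f, fun hf => ?_, ?_⟩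
  · have := congrFun hf (.inl i)
    simp [f, u, fromBlocks_mulVec, hij, hs] at this
  · rw [mulVec_sub, mulVec_smul, ← sub_eq_zero, ← hsq]
    module

theorem designConfig_mem_span (h : IsDesignWithBlockGraph M X t s lam r k e y c d)
    (hM01 : ∀ i j, M i j = 0 ∨ M i j = 1) (hX01 : ∀ i j, X i j = 0 ∨ X i j = 1)
    (hdeg : r ≠ k + e) {ρ : ℕ} {A : Fin ρ → Matrix (m ⊕ n) (m ⊕ n) ℝ}
    (hA : IsCoherentConfig A) (hadj : fromBlocks 0 M Mᵀ X ∈ Submodule.span ℝ (Set.range A))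
    (i : Fin 9) : designConfig M X i ∈ Submodule.span ℝ (Set.range A) := by
  have hMsq : ∀ i j, M i j * M i j = M i j := fun i j => by rcases hM01 i j with h | h <;> simp [h]
  have hXsq : ∀ i j, X i j * X j i = X i j := fun i j => by
    have : X j i = X i j := congrFun (congrFun h.symm i) j
    rcases hX01 i j with h' | h' <;> simp [this, h']
  have hD : (1 : Matrix (m ⊕ n) (m ⊕ n) ℝ) ⊙ (fromBlocks 0 M Mᵀ X * fromBlocks 0 M Mᵀ X)
      = fromBlocks (r • 1) 0 0 ((k + e) • 1) := by
    rw [one_hadamard, fromBlocks_multiply]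
    ext (p | p) (q | q)
    · by_cases hpq : p = q
      · subst hpq
        simp [Matrix.mul_apply, hMsq, h.row_sum]
      · simp [hpq]
    · simp
    · simp
    · by_cases hpq : p = q
      · subst hpq
        simp [Matrix.mul_apply, hMsq, hXsq, h.col_sum, h.deg]
      · simp [hpq]
  set W := Submodule.span ℝ (Set.range A)
  have hDW : fromBlocks (r • 1) 0 0 ((k + e) • 1) ∈ W :=
    hD ▸ hA.hadamard_mem_span hA.one_mem_span (hA.mul_mem_span hadj hadj)
  have hdeg' : r - (k + e) ≠ 0 := sub_ne_zero.2 hdeg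
  have hE : fromBlocks (1 : Matrix m m ℝ) 0 0 (0 : Matrix n n ℝ) ∈ W := by
    have : fromBlocks (1 : Matrix m m ℝ) 0 0 (0 : Matrix n n ℝ)
        = (r - (k + e))⁻¹ • (fromBlocks (r • 1) 0 0 ((k + e) • 1) - (k + e) • 1) := by
      rw [eq_inv_smul_iff₀ hdeg', eq_sub_iff_add_eq, ← fromBlocks_one, fromBlocks_smul,
        fromBlocks_smul, fromBlocks_add]
      simp [← add_smul]
    exact this ▸ W.smul_mem _ (W.sub_mem hDW (W.smul_mem _ hA.one_mem_span))
  have hF : fromBlocks (0 : Matrix m m ℝ) 0 0 (1 : Matrix n n ℝ) ∈ W := by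
    have : fromBlocks (0 : Matrix m m ℝ) 0 0 (1 : Matrix n n ℝ)
        = 1 - fromBlocks (1 : Matrix m m ℝ) 0 0 (0 : Matrix n n ℝ) := by
      rw [eq_sub_iff_add_eq, fromBlocks_add]
      simp
    exact this ▸ W.sub_mem hA.one_mem_span hE
  have hblocks : ∀ P Q R S, fromBlocks P Q R S ∈ W →
      fromBlocks P 0 0 0 ∈ W ∧ fromBlocks 0 Q 0 0 ∈ W ∧ fromBlocks 0 0 R 0 ∈ W ∧
        fromBlocks 0 0 0 S ∈ W := fun P Q R S hW => by
    refine ⟨?_, ?_, ?_, ?_⟩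
    · simpa [fromBlocks_multiply] using hA.mul_mem_span (hA.mul_mem_span hE hW) hE
    · simpa [fromBlocks_multiply] using hA.mul_mem_span (hA.mul_mem_span hE hW) hF
    · simpa [fromBlocks_multiply] using hA.mul_mem_span (hA.mul_mem_span hF hW) hE
    · simpa [fromBlocks_multiply] using hA.mul_mem_span (hA.mul_mem_span hF hW) hF
  obtain ⟨-, hM, hMt, hX⟩ := hblocks _ _ _ _ hadj
  have hJ : fromBlocks (allOnes m m) (allOnes m n) (allOnes n m) (allOnes n n) ∈ W := by
    convert hA.allOnes_mem_span using 1
    ext (p | p) (q | q) <;> simp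
  obtain ⟨hJ₁₁, hJ₁₂, hJ₂₁, hJ₂₂⟩ := hblocks _ _ _ _ hJ
  fin_cases i
  · exact hE
  · simpa [designConfig, sub_eq_add_neg, fromBlocks_neg, fromBlocks_add] using W.sub_mem hJ₁₁ hE
  · exact hM
  · simpa [designConfig, sub_eq_add_neg, fromBlocks_neg, fromBlocks_add] using W.sub_mem hJ₁₂ hM
  · exact hMt
  · simpa [designConfig, sub_eq_add_neg, fromBlocks_neg, fromBlocks_add] using W.sub_mem hJ₂₁ hMt
  · exact hF
  · exact hX
  · simpa [designConfig, sub_eq_add_neg, fromBlocks_neg, fromBlocks_add] using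
      W.sub_mem (W.sub_mem hJ₂₂ hF) hX

theorem designConfig_ne_zero (h : IsDesignWithBlockGraph M X t s lam r k e y c d)
    [Nontrivial m] [Nonempty n] (hk : k ≠ 0) (ht : t ≠ 0) (hs : s ≠ 0) (hX0 : X ≠ 0)
    (hXJ : X ≠ allOnes n n - 1) (i : Fin 9) : designConfig M X i ≠ 0 := by
  obtain ⟨p, q, hpq⟩ := exists_pair_ne m
  have hM0 : M ≠ 0 := by
    rintro rfl
    exact hk (by simpa using (h.col_sum (Classical.arbitrary n)).symm)
  have hMJ : allOnes m n ≠ M := by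
    rintro rfl
    have hpp := congrFun (congrFun h.mul_transpose p) p
    have hpq' := congrFun (congrFun h.mul_transpose p) q
    simp [Matrix.mul_apply, hpq] at hpp hpq'
    exact mul_ne_zero ht hs (by linarith)
  have hJ1 : allOnes m m ≠ 1 := fun hJ => by
    simpa [hpq] using congrFun (congrFun hJ p) q
  have hMtJ : allOnes n m ≠ Mᵀ := fun hJ => hMJ (congrArg transpose hJ)
  have hblocks : ∀ (P : Matrix m m ℝ) (Q : Matrix m n ℝ) (R : Matrix n m ℝ) (S : Matrix n n ℝ),
      fromBlocks P Q R S = 0 ↔ P = 0 ∧ Q = 0 ∧ R = 0 ∧ S = 0 := fun P Q R S => by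
    rw [← fromBlocks_zero, fromBlocks_inj]
  fin_cases i <;>
    simp [designConfig, hblocks, sub_eq_zero, hM0, hMJ, hMtJ, hJ1, hX0, Ne.symm hXJ]

theorem isLeast_rank (h : IsDesignWithBlockGraph M X t s lam r k e y c d)
    [Nontrivial m] [Nonempty n] (hM01 : ∀ i j, M i j = 0 ∨ M i j = 1)
    (hX01 : ∀ i j, X i j = 0 ∨ X i j = 1) (hXdiag : ∀ i, X i i = 0) (hk : k ≠ 0) (ht : t ≠ 0)
    (hs : s ≠ 0) (hX0 : X ≠ 0) (hXJ : X ≠ allOnes n n - 1) (hdeg : r ≠ k + e) :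
    IsLeast {ρ : ℕ | ∃ A : Fin ρ → Matrix (m ⊕ n) (m ⊕ n) ℝ, IsCoherentConfig A ∧
      fromBlocks 0 M Mᵀ X ∈ Submodule.span ℝ (Set.range A)} 9 := by
  have hconfig := h.isCoherentConfig hM01 hX01 hXdiag
  refine ⟨⟨designConfig M X, hconfig, ?_⟩, ?_⟩
  · simpa [designCombination] using
      designCombination_mem_span M X ![0, 0, 1, 0, 1, 0, 0, 1, 0]
  · rintro ρ ⟨A, hA, hadj⟩
    simpa using LinearIndependent.card_le_of_mem_span
      (linearIndependent_of_sum_eq_allOnes hconfig.1 hconfig.2.1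
        (h.designConfig_ne_zero hk ht hs hX0 hXJ))
      (h.designConfig_mem_span hM01 hX01 hdeg hA hadj)

end IsDesignWithBlockGraph

end Design

/-- The design parameters satisfy a quadratic equation in `y`; the quotient matrix
`[[0, r], [k, e]]` then has eigenvalues `θ` and `s`. -/
theorem quasiSymmetric_parameters {t s θ y lam r k b : ℝ} (ht : 1 ≤ t) (hs : s ≤ -2)
    (hθ : θ = (t * (t ^ 2 + t + 1) - 2 * s * (t + 1)
      + t * Real.sqrt ((t ^ 2 + t + 1) ^ 2 - 4 * t * s * (t + 1))) / 2)
    (hy : t * y = θ + s - t ^ 3 + t * s) (hlam : t * lam = -s * (y - t - 1))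
    (hr : r = lam - t * s) (hk : k = y + t ^ 2) (hb : b = r - k + (θ + s) + 1) :
    y * (y + t ^ 2 - t - 1) = t * (t + 1) * (t - s) ∧ r * k = -(θ * s) ∧
      (t ^ 2 + y * b - r * k) / t = θ + s := by
  have ht0 : t ≠ 0 := by positivity
  have hsqrt : Real.sqrt ((t ^ 2 + t + 1) ^ 2 - 4 * t * s * (t + 1)) ^ 2
      = (t ^ 2 + t + 1) ^ 2 - 4 * t * s * (t + 1) := by
    refine Real.sq_sqrt ?_
    have : 0 ≤ t * (-s) * (t + 1) :=
      mul_nonneg (mul_nonneg (by linarith) (by linarith)) (by linarith)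
    nlinarith [sq_nonneg (t ^ 2 + t + 1)]
  have hθsq : θ ^ 2 - (t * (t ^ 2 + t + 1) - 2 * s * (t + 1)) * θ
      + s * (s - t) * (t + 1) ^ 2 = 0 := by
    rw [hθ]
    linear_combination t ^ 2 / 4 * hsqrt
  obtain rfl : θ = t * y + t ^ 3 - t * s - s := by linarith
  have hquad : y * (y + t ^ 2 - t - 1) = t * (t + 1) * (t - s) := by
    refine mul_left_cancel₀ (pow_ne_zero 2 ht0) ?_
    linear_combination hθsq
  have hrk : r * k = -((t * y + t ^ 3 - t * s - s) * s) := by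
    refine mul_left_cancel₀ ht0 ?_
    rw [hr, hk]
    linear_combination (y + t ^ 2) * hlam - s * hquad
  refine ⟨hquad, hrk, ?_⟩
  rw [div_eq_iff ht0, hrk]
  refine mul_left_cancel₀ ht0 ?_
  rw [hb, hr, hk]
  linear_combination y * hlam + (t ^ 2 - t - s) * hquad

/-- Class 2 converse: for integers `θ1 ≥ 1`, `θ2 ≤ -2`, with
`θ0 = (θ1(θ1²+θ1+1) - 2θ2(θ1+1) + θ1 √((θ1²+θ1+1)² - 4θ1θ2(θ1+1)))/2` and `e0 = θ0+θ2`,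
given a quasi-symmetric design with the stated integer parameters, the graph with block
adjacency matrix `[[O, M],[Mᵀ, X]]` is connected with eigenvalue set exactly `{θ0,θ1,θ2}`,
and if `r ≠ k + θ0 + θ2` it has coherent rank `9`. -/
theorem stmt12 (θ1 θ2 : ℤ) (hθ1 : 1 ≤ θ1) (hθ2 : θ2 ≤ -2) (θ0 e0 : ℝ)
    (hθ0 : θ0 = ((θ1 : ℝ) * ((θ1 : ℝ) ^ 2 + (θ1 : ℝ) + 1) - 2 * (θ2 : ℝ) * ((θ1 : ℝ) + 1)
      + (θ1 : ℝ) * Real.sqrt (((θ1 : ℝ) ^ 2 + (θ1 : ℝ) + 1) ^ 2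
          - 4 * (θ1 : ℝ) * (θ2 : ℝ) * ((θ1 : ℝ) + 1))) / 2)
    (he0 : e0 = θ0 + (θ2 : ℝ))
    (v b k r lam : ℕ) (x y : ℤ)
    (hv : 0 < v) (hb : 0 < b) (hk : 0 < k) (hr : 0 < r) (hlam : 0 < lam)
    (hx0 : 0 ≤ x) (hy0 : 0 ≤ y)
    (hyeq : (y : ℝ) = (e0 - (θ1 : ℝ) ^ 3 + (θ1 : ℝ) * (θ2 : ℝ)) / (θ1 : ℝ))
    (hxeq : (x : ℝ) = (y : ℝ) - (θ1 : ℝ))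
    (hleq : (lam : ℝ) = -(θ2 : ℝ) * ((x : ℝ) - 1) / (θ1 : ℝ))
    (hreq : (r : ℝ) = (lam : ℝ) - (θ1 : ℝ) * (θ2 : ℝ))
    (hkeq : (k : ℝ) = (y : ℝ) + (θ1 : ℝ) ^ 2)
    (hveq : (v : ℝ) = -(θ2 : ℝ) * (θ0 - (θ1 : ℝ)) / (lam : ℝ))
    (hbeq : (b : ℝ) = (r : ℝ) - (k : ℝ) + e0 + 1)
    (M : Matrix (Fin v) (Fin b) ℝ)
    (hM01 : ∀ i j, M i j = 0 ∨ M i j = 1)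
    (hrow : ∀ i, ∑ j, M i j = (r : ℝ))
    (hcol : ∀ j, ∑ i, M i j = (k : ℝ))
    (hMMt : M * Mᵀ = ((r : ℝ) - lam) • (1 : Matrix (Fin v) (Fin v) ℝ)
      + (lam : ℝ) • Matrix.of (fun _ _ => 1))
    (X : Matrix (Fin b) (Fin b) ℝ)
    (hXsymm : Xᵀ = X) (hXdiag : ∀ i, X i i = 0) (hX01 : ∀ i j, X i j = 0 ∨ X i j = 1)
    (hXne0 : X ≠ 0)
    (hXneJ : X ≠ Matrix.of (fun _ _ => 1) - (1 : Matrix (Fin b) (Fin b) ℝ))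
    (hMtM : Mᵀ * M = (k : ℝ) • (1 : Matrix (Fin b) (Fin b) ℝ) + (x : ℝ) • X
      + (y : ℝ) • (Matrix.of (fun _ _ => 1) - (1 : Matrix (Fin b) (Fin b) ℝ) - X)) :
    ∀ (G : SimpleGraph (Fin v ⊕ Fin b)) [DecidableRel G.Adj],
      SimpleGraph.adjMatrix ℝ G = Matrix.fromBlocks 0 M Mᵀ X →
      G.Connected ∧
      {θ : ℝ | adjEig G θ} = {θ0, (θ1 : ℝ), (θ2 : ℝ)} ∧
      ((r : ℝ) ≠ (k : ℝ) + θ0 + (θ2 : ℝ) → HasCoherentRank G 9) := by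
  intro G _ hG
  have ht : (1 : ℝ) ≤ θ1 := by exact_mod_cast hθ1
  have hs : (θ2 : ℝ) ≤ -2 := by exact_mod_cast hθ2
  have hy0' : (0 : ℝ) ≤ y := by exact_mod_cast hy0
  generalize (θ1 : ℝ) = t at *
  generalize (θ2 : ℝ) = s at *
  generalize (y : ℝ) = y at *
  generalize (x : ℝ) = x at *
  have ht0 : t ≠ 0 := by positivity
  have hs0 : s ≠ 0 := by linarith
  have hk0 : (k : ℝ) ≠ 0 := by positivity
  have hr0 : (r : ℝ) ≠ 0 := by positivity
  have hlam0 : (lam : ℝ) ≠ 0 := by positivity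
  subst he0 hxeq
  obtain ⟨hquad, hrk, he⟩ := quasiSymmetric_parameters (lam := lam) (r := r) (k := k) (b := b)
    ht hs hθ0 (by rw [hyeq]; field_simp) (by rw [hleq]; field_simp) hreq hkeq hbeq
  obtain ⟨c, d, h⟩ := IsDesignWithBlockGraph.of_quasiSymmetric (M := M) (X := X) (s := s)
    (lam := lam) (y := y) (b := b) (by simp) ht0 hrow hcol hXsymm
    (by rw [hMMt, hreq]; ring_nf) (by rw [hMtM, hkeq]; module)
  rw [he] at h
  have : NeZero b := ⟨hb.ne'⟩
  have : Nontrivial (Fin v) := by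
    have hkv : (k : ℝ) ≤ v := by
      rw [← hcol 0]
      calc ∑ i, M i 0 ≤ ∑ _i : Fin v, (1 : ℝ) :=
            Finset.sum_le_sum fun i _ => by rcases hM01 i 0 with h | h <;> simp [h]
        _ = v := by simp
    have hk1 : (1 : ℝ) < k := by
      have hy : y ≠ 0 := by
        rintro rfl
        have : 0 < t * (t + 1) * (t - s) := by
          have : 0 < t - s := by linarith
          positivity
        linarith
      have : 0 < y := lt_of_le_of_ne hy0' hy.symm
      nlinarith
    rw [Fin.nontrivial_iff_two_le]
    exact_mod_cast hk1.trans_le hkv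
  refine ⟨h.connected hlam0 hk0 hG, ?_, fun hdeg => ?_⟩
  · ext z
    simp only [Set.mem_ofPred_eq, Set.mem_insert_iff, Set.mem_singleton_iff, adjEig, hG]
    refine ⟨fun ⟨f, hf, hz⟩ => h.eigenvalue_eq hk0 rfl hrk hf hz, ?_⟩
    have hquot : ∀ z : ℝ, z ^ 2 = (θ0 + s) * z + r * k →
        ∃ f, f ≠ 0 ∧ fromBlocks 0 M Mᵀ X *ᵥ f = z • f := fun z hz =>
      ⟨_, fun hf => hr0 (congrFun hf (.inl (Classical.arbitrary (Fin v)))),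
        h.adj_mulVec_quotient hz⟩
    rintro (rfl | rfl | rfl)
    · exact hquot _ (by linear_combination -hrk)
    · exact h.exists_eigenvector hs0
    · exact hquot _ (by linear_combination -hrk)
  · rw [HasCoherentRank, hG]
    exact h.isLeast_rank hM01 hX01 hXdiag hk0 ht0 hs0 hXne0 hXneJ (by rwa [← add_assoc])
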